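/- Let K be a field of characteristic zero, let a0(x), a1(x), a2(x) ∈ K[x], and let D = y∂x + (a2(x)y² + a1(x)y + a0(x))∂y be the K-derivation of K[x,y]. Then D is simple if and only if the following three conditions hold: (1) a0(x) is a nonzero constant (a0(x) ∈ K*); (2) deg a1(x) ≥ 1 or deg a2(x) ≥ 1; (3) there exists no l ∈ K* such that a2(x) = l·a1(x) − l²·a0(x). -/

import Mathlib

/-- A `K`-derivation `D` of `R` is *simple* if `R` has no `D`-stable ideal
other than `0` and `R`. -/
def Derivation.IsSimple {K R : Type*} [CommRing K] [CommRing R] [Algebra K R]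
    (D : Derivation K R R) : Prop :=
  ∀ I : Ideal R, (∀ a ∈ I, D a ∈ I) → I = ⊥ ∨ I = ⊤

open Polynomial

section Chain

variable {K : Type*} [Field K]

/-- `IsShift a t` says that the operator `g ↦ g' - m * a * g` raises degrees by `t`. -/
def IsShift (a : K[X]) (t : ℤ) : Prop :=
  (a = 0 ∧ t = -1) ∨ (a ≠ 0 ∧ t = a.natDegree)

lemma exists_isShift (a : K[X]) : ∃ t : ℤ, IsShift a t := by
  by_cases h : a = 0
  · exact ⟨-1, Or.inl ⟨h, rfl⟩⟩
  · exact ⟨_, Or.inr ⟨h, rfl⟩⟩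

variable [CharZero K]

lemma natDegree_C_mul_mul_of_ne_zero {a g : K[X]} {m : ℕ} (hm : 0 < m) (ha : a ≠ 0) (hg : g ≠ 0) :
    (C (m : K) * a * g).natDegree = a.natDegree + g.natDegree := by
  have : (m : K) ≠ 0 := by exact_mod_cast hm.ne'
  rw [mul_assoc, natDegree_C_mul this, natDegree_mul ha hg]

lemma degree_derivative_lt_mul {a g : K[X]} {m : ℕ} (hm : 0 < m) (ha : a ≠ 0) (hg : g ≠ 0) :
    (derivative g).degree < (C (m : K) * a * g).degree := by
  have hm' : (m : K) ≠ 0 := by exact_mod_cast hm.ne'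
  refine (degree_derivative_lt hg).trans_le ?_
  rw [mul_assoc, degree_C_mul hm', degree_mul]
  exact le_add_of_nonneg_left (zero_le_degree_iff.2 ha)

/-- The degree shift of `g ↦ g' - m * a * g`. -/
lemma IsShift.natDegree_eq {a g r : K[X]} {t : ℤ} (ht : IsShift a t) {m : ℕ} (hm : 0 < m)
    (h : derivative g - C (m : K) * a * g = r) (hr : r ≠ 0) :
    g ≠ 0 ∧ (g.natDegree : ℤ) + t = r.natDegree := by
  have hg : g ≠ 0 := by rintro rfl; simp at h; exact hr h.symm
  refine ⟨hg, ?_⟩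
  rcases ht with ⟨rfl, rfl⟩ | ⟨ha, rfl⟩
  · have h' : derivative g = r := by simpa using h
    have h0 : g.natDegree ≠ 0 := fun h0 => hr (by rw [← h', derivative_of_natDegree_zero h0])
    have := natDegree_derivative g
    rw [h'] at this
    omega
  · rw [← h, natDegree_eq_of_degree_eq
      (degree_sub_eq_right_of_degree_lt (degree_derivative_lt_mul hm ha hg)),
      natDegree_C_mul_mul_of_ne_zero hm ha hg]
    push_cast; ring

/-- The kernel of `g ↦ g' - m * a * g`. -/
lemma IsShift.natDegree_eq_zero {a g : K[X]} {m : ℕ} (hm : 0 < m)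
    (h : derivative g - C (m : K) * a * g = 0) : g.natDegree = 0 ∧ (a ≠ 0 → g = 0) := by
  by_cases ha : a = 0
  · subst ha
    exact ⟨derivative_eq_zero.1 (by simpa using h), fun h => (h rfl).elim⟩
  · have : g = 0 := by
      by_contra hg
      have := degree_derivative_lt_mul (K := K) hm ha hg
      rw [sub_eq_zero.1 h] at this
      exact this.false
    simp [this]

/-- The recursion satisfied by the coefficients `h (k + 1)` of `y ^ k` in a Darboux polynomial of
`y ∂x + (a2 y² + a1 y + c) ∂y` of degree `n` in `y`. -/
structure DarbouxChain (c : K) (a1 a2 μ : K[X]) (n : ℕ) (h : ℕ → K[X]) : Prop where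
  zero : h 0 = 0
  top_ne : h (n + 1) ≠ 0
  top_natDegree : (h (n + 1)).natDegree = 0
  vanish : ∀ k, n + 1 < k → h k = 0
  recurrence : ∀ k ≤ n, derivative (h k) - C ((n + 1 - k : ℕ) : K) * a2 * h k =
    (μ - C (k : K) * a1) * h (k + 1) - C (((k + 1 : ℕ) : K) * c) * h (k + 2)

namespace DarbouxChain

variable {c : K} {a1 a2 μ : K[X]} {n : ℕ} {h : ℕ → K[X]} {t : ℤ}

lemma step' (H : DarbouxChain c a1 a2 μ n h) (ht : IsShift a2 t) {k : ℕ} (hk : k ≤ n)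
    (hQ : μ - C (k : K) * a1 ≠ 0) (hne : h (k + 1) ≠ 0)
    (hlt : (h (k + 2)).degree < ((μ - C (k : K) * a1) * h (k + 1)).degree) :
    h k ≠ 0 ∧ ((h k).natDegree : ℤ) + t =
      (μ - C (k : K) * a1).natDegree + (h (k + 1)).natDegree := by
  have hlt' : (C (((k + 1 : ℕ) : K) * c) * h (k + 2)).degree
      < ((μ - C (k : K) * a1) * h (k + 1)).degree := by
    refine lt_of_le_of_lt ?_ hlt
    rw [degree_mul]
    calc _ ≤ 0 + (h (k + 2)).degree := by gcongr; exact degree_C_le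
      _ = _ := zero_add _
  have hd := degree_sub_eq_left_of_degree_lt hlt'
  have hr := (H.recurrence k hk)
  obtain ⟨h1, h2⟩ := ht.natDegree_eq (by omega) hr (by
    intro h0
    rw [h0, degree_zero, eq_comm, degree_eq_bot] at hd
    exact mul_ne_zero hQ hne hd)
  refine ⟨h1, ?_⟩
  rw [h2, natDegree_eq_of_degree_eq hd, natDegree_mul hQ hne]
  push_cast; ring

lemma step (H : DarbouxChain c a1 a2 μ n h) (ht : IsShift a2 t) {k : ℕ} (hk : k ≤ n)
    (hne : h (k + 1) ≠ 0)
    (hlt : (h (k + 2)).natDegree < (h (k + 1)).natDegree + (μ - C (k : K) * a1).natDegree)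
    (hQ : μ - C (k : K) * a1 ≠ 0) :
    h k ≠ 0 ∧ ((h k).natDegree : ℤ) + t = (μ - C (k : K) * a1).natDegree + (h (k + 1)).natDegree :=
  H.step' ht hk hQ hne (degree_lt_degree (by rw [natDegree_mul hQ hne]; omega))

lemma descent (H : DarbouxChain c a1 a2 μ n h) (ht : IsShift a2 t) {e : ℕ} (he : 1 ≤ e)
    (hte : t ≤ e) {k : ℕ} (hk : k ≤ n + 1)
    (hQ : ∀ i < k, e ≤ (μ - C (i : K) * a1).natDegree)
    (hne : h k ≠ 0) (hlt : (h (k + 1)).natDegree < (h k).natDegree + e) : False := by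
  induction k with
  | zero => exact hne H.zero
  | succ k ih =>
    have h1 := hQ k (by omega)
    have h2 : μ - C (k : K) * a1 ≠ 0 := by
      intro h0; rw [h0, natDegree_zero] at h1; omega
    obtain ⟨h3, h4⟩ := H.step ht (by omega) hne
      (by rw [show k + 1 + 1 = k + 2 from rfl] at hlt; omega) h2
    exact ih (by omega) (fun i hi => hQ i (by omega)) h3 (by omega)

/-- If `deg a1 < deg a2` there is no chain. -/
lemma false_of_lt (H : DarbouxChain c a1 a2 μ n h) (hn : 1 ≤ n) (hc : c ≠ 0)
    (ht : IsShift a2 t) (ht1 : 1 ≤ t) (hQ : ((μ - C (n : K) * a1).natDegree : ℤ) < t) : False := by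
  have hv : h (n + 2) = 0 := H.vanish _ (by omega)
  have h1 := H.recurrence n le_rfl
  rw [hv, mul_zero, sub_zero] at h1
  have ha2 : a2 ≠ 0 := by rcases ht with ⟨-, rfl⟩ | ⟨h, -⟩; omega; exact h
  have hQ0 : μ - C (n : K) * a1 = 0 := by
    by_contra h0
    have := (ht.natDegree_eq (by omega) h1 (mul_ne_zero h0 H.top_ne)).2
    rw [natDegree_mul h0 H.top_ne, H.top_natDegree] at this
    omega
  rw [hQ0, zero_mul] at h1
  have hn0 := (IsShift.natDegree_eq_zero (by omega) h1).2 ha2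
  obtain ⟨k, rfl⟩ : ∃ k, n = k + 1 := ⟨n - 1, by omega⟩
  have h2 := H.recurrence k (by omega)
  rw [hn0, mul_zero, zero_sub] at h2
  have hk : ((k + 1 : ℕ) : K) * c ≠ 0 := mul_ne_zero (by exact_mod_cast k.succ_ne_zero) hc
  have := (ht.natDegree_eq (by omega) h2 (neg_ne_zero.2
    (mul_ne_zero (C_ne_zero.2 hk) H.top_ne))).2
  rw [natDegree_neg, natDegree_C_mul hk, H.top_natDegree] at this
  omega

/-- If `deg a1 = deg a2` the chain consists of constants. -/
lemma natDegree_eq_zero (H : DarbouxChain c a1 a2 μ n h)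
    (ht : IsShift a2 t) (ht1 : 1 ≤ t) (hQ : ∀ i ≤ n, ((μ - C (i : K) * a1).natDegree : ℤ) ≤ t)
    (k : ℕ) : (h k).natDegree = 0 := by
  by_cases hk : n < k
  · rcases eq_or_ne k (n + 1) with rfl | h1
    · exact H.top_natDegree
    · rw [H.vanish k (by omega), natDegree_zero]
  · have h1 := natDegree_eq_zero H ht ht1 hQ (k + 1)
    have h2 := natDegree_eq_zero H ht ht1 hQ (k + 2)
    have h3 := H.recurrence k (by omega)
    by_cases hr : (μ - C (k : K) * a1) * h (k + 1) - C (((k + 1 : ℕ) : K) * c) * h (k + 2) = 0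
    · rw [hr] at h3
      exact (IsShift.natDegree_eq_zero (by omega) h3).1
    · have h4 := (ht.natDegree_eq (by omega) h3 hr).2
      have h5 := natDegree_sub_le ((μ - C (k : K) * a1) * h (k + 1))
        (C (((k + 1 : ℕ) : K) * c) * h (k + 2))
      have h6 := natDegree_mul_le (p := μ - C (k : K) * a1) (q := h (k + 1))
      have h7 := natDegree_C_mul_le (((k + 1 : ℕ) : K) * c) (h (k + 2))
      have h8 := hQ k (by omega)
      omega
termination_by n + 1 - k

/-- Above the resonant index the degrees strictly increase as the index decreases. -/
lemma ascent (H : DarbouxChain c a1 a2 μ n h) (ht : IsShift a2 t) {d N : ℕ} (hd : 1 ≤ d)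
    (htd : t < d) (hQ : ∀ i ≤ n, N < i → (μ - C (i : K) * a1).natDegree = d)
    (k : ℕ) (hNk : N < k) (hk : k ≤ n + 1) : h k ≠ 0 ∧
      (h (k + 1)).natDegree < (h k).natDegree + d ∧
      (k ≤ n → ((h k).natDegree : ℤ) + t = d + (h (k + 1)).natDegree) := by
  rcases eq_or_ne k (n + 1) with rfl | h1
  · refine ⟨H.top_ne, ?_, by omega⟩
    rw [H.vanish (n + 1 + 1) (by omega), natDegree_zero]; omega
  · obtain ⟨h2, h3, -⟩ := ascent H ht hd htd hQ (k + 1) (by omega) (by omega)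
    have h4 := hQ k (by omega) hNk
    obtain ⟨h5, h6⟩ := H.step ht (by omega) h2
      (by rw [show k + 1 + 1 = k + 2 from rfl] at h3; omega)
      (by intro h0; rw [h0, natDegree_zero] at h4; omega)
    refine ⟨h5, ?_, ?_⟩ <;> omega
termination_by n + 1 - k

end DarbouxChain

lemma resonance_aux {c : K} (hc : c ≠ 0) {a1 a2 U A R S : K[X]} {N a : ℕ} {e1 e2 : K}
    (hd : 1 ≤ a1.natDegree) (hA : A ≠ 0) (ha : A.natDegree = a)
    (hau : a = a1.natDegree + U.natDegree)
    (hR : R = a1 * U - C (N * c) * A)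
    (hS : S.degree < (a - 1 : ℕ))
    (hE : a1 * derivative U - C ((N + 1) * c) * derivative A =
      C e1 * a2 * R + C e2 * a2 * A + S) :
    R ≠ 0 ∧ (a ≤ R.natDegree ∨ (a2 ≠ 0 ∧ a ≤ R.natDegree + a2.natDegree + 1)) := by
  by_cases hRa : R.coeff a = 0
  · have hSc (i : ℕ) (hi : a - 1 ≤ i) : S.coeff i = 0 :=
      coeff_eq_zero_of_degree_lt (hS.trans_le (by exact_mod_cast hi))
    have hlA : A.coeff a ≠ 0 := by rw [← ha]; exact leadingCoeff_ne_zero.2 hA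
    have hRd : R.natDegree ≤ a := by
      rw [hR]
      refine (natDegree_sub_le _ _).trans (max_le (hau ▸ natDegree_mul_le) ?_)
      exact (natDegree_C_mul_le _ _).trans ha.le
    have hrel : a1.coeff a1.natDegree * U.coeff U.natDegree = N * c * A.coeff a := by
      rw [hR, coeff_sub, coeff_C_mul, hau, coeff_mul_add_eq_of_natDegree_le le_rfl le_rfl,
        ← hau] at hRa
      exact sub_eq_zero.1 hRa
    obtain ⟨b, hb⟩ : ∃ b, a = b + 1 := ⟨a - 1, by omega⟩
    have hL : (a1 * derivative U - C ((N + 1) * c) * derivative A).coeff b =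
        c * A.coeff a * ((N * U.natDegree : ℕ) - ((N + 1) * a : ℕ)) := by
      have h1 : (a1 * derivative U).coeff b =
          a1.coeff a1.natDegree * (U.coeff U.natDegree * U.natDegree) := by
        rcases Nat.eq_zero_or_pos U.natDegree with h0 | h0
        · rw [derivative_of_natDegree_zero h0, h0]; simp
        · have : b = a1.natDegree + (U.natDegree - 1) := by omega
          rw [this, coeff_mul_add_eq_of_natDegree_le le_rfl (natDegree_derivative U).le,
            coeff_derivative,
            Nat.sub_add_cancel h0]
          congr 2
          exact_mod_cast Nat.sub_add_cancel h0
      rw [coeff_sub, h1, coeff_C_mul, coeff_derivative, ← hb, ← mul_assoc, hrel, hb]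
      push_cast; ring
    have hL0 : (a1 * derivative U - C ((N + 1) * c) * derivative A).coeff b ≠ 0 := by
      rw [hL]
      refine mul_ne_zero (mul_ne_zero hc hlA) (sub_ne_zero.2 ?_)
      have : N * U.natDegree < (N + 1) * a := by nlinarith
      exact_mod_cast this.ne
    have he2 : C e2 * a2 = 0 := by
      by_contra h0
      have ha2 : a2 ≠ 0 := right_ne_zero_of_mul h0
      have he : e2 ≠ 0 := fun h => h0 (by simp [h])
      have h1 := congrArg (fun p => p.coeff (a2.natDegree + a)) hE
      have h2 : (a1 * derivative U - C ((N + 1) * c) * derivative A).coeff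
          (a2.natDegree + a) = 0 := by
        refine coeff_eq_zero_of_natDegree_lt (lt_of_le_of_lt (b := b) ?_ (by omega))
        refine (natDegree_sub_le _ _).trans (max_le ?_ ?_)
        · rcases Nat.eq_zero_or_pos U.natDegree with h0 | h0
          · rw [derivative_of_natDegree_zero h0]; simp
          · exact natDegree_mul_le.trans (by rw [natDegree_derivative]; omega)
        · exact (natDegree_C_mul_le _ _).trans (by rw [natDegree_derivative]; omega)
      simp only [h2, coeff_add, mul_assoc, coeff_C_mul] at h1
      rw [coeff_mul_add_eq_of_natDegree_le le_rfl hRd,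
        coeff_mul_add_eq_of_natDegree_le le_rfl ha.le, hRa,
        hSc _ (by omega)] at h1
      simp [he, hlA, ha2] at h1
    rw [hE, he2, zero_mul, add_zero, coeff_add, hSc b (by omega), add_zero, mul_assoc,
      coeff_C_mul] at hL0
    have h3 : (a2 * R).coeff b ≠ 0 := right_ne_zero_of_mul hL0
    have h4 : a2 * R ≠ 0 := by intro h; simp [h] at h3
    have h5 := le_natDegree_of_ne_zero h3
    rw [natDegree_mul (left_ne_zero_of_mul h4) (right_ne_zero_of_mul h4)] at h5
    exact ⟨right_ne_zero_of_mul h4, Or.inr ⟨left_ne_zero_of_mul h4, by omega⟩⟩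
  · exact ⟨by rintro h; simp [h] at hRa, Or.inl (le_natDegree_of_ne_zero hRa)⟩

namespace DarbouxChain

variable {c : K} {a1 a2 μ : K[X]} {n : ℕ} {h : ℕ → K[X]} {t : ℤ}

/-- If `deg a2 < deg a1` there is no chain whose resonance is not exact. -/
lemma false_of_ne (H : DarbouxChain c a1 a2 μ n h) (ht : IsShift a2 t) (hd : 1 ≤ a1.natDegree)
    (htd : t < a1.natDegree) {N : ℕ} (hN : N ≤ n)
    (hQ : ∀ i ≤ n, i ≠ N → (μ - C (i : K) * a1).natDegree = a1.natDegree)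
    (hρ : μ - C (N : K) * a1 ≠ 0) : False := by
  have hasc := H.ascent ht hd htd (N := N) (fun i hi hNi => hQ i hi hNi.ne')
  obtain ⟨h1, h2, h3⟩ := hasc (N + 1) (by omega) (by omega)
  obtain ⟨h4, h5⟩ := H.step' ht hN hρ h1 (by
    rw [degree_mul]
    refine lt_of_lt_of_le (b := (h (N + 1)).degree) ?_
      (le_add_of_nonneg_left (zero_le_degree_iff.2 hρ))
    by_cases hNn : N + 1 ≤ n
    · exact degree_lt_degree (by
        have := h3 hNn; rw [show N + 1 + 1 = N + 2 from rfl] at this; omega)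
    · rw [H.vanish (N + 2) (by omega), degree_zero]
      exact bot_lt_iff_ne_bot.2 (degree_ne_bot.2 h1))
  exact H.descent ht hd htd.le (by omega) (fun i hi => (hQ i (by omega) hi.ne).ge) h4 (by omega)

/-- If `deg a2 < deg a1` there is no chain with an exact resonance. -/
lemma false_of_eq (H : DarbouxChain c a1 a2 μ n h) (hn : 1 ≤ n) (hc : c ≠ 0) (ht : IsShift a2 t)
    (hd : 1 ≤ a1.natDegree)
    (htd : t < a1.natDegree) {N : ℕ} (hN : N ≤ n)
    (hQ : ∀ i ≤ n, i ≠ N → (μ - C (i : K) * a1).natDegree = a1.natDegree)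
    (hρ : μ - C (N : K) * a1 = 0) : False := by
  have hcN (k : ℕ) : ((k + 1 : ℕ) : K) * c ≠ 0 := mul_ne_zero (by exact_mod_cast k.succ_ne_zero) hc
  have hQ0 {i : ℕ} (hi : i ≤ n) (hiN : i ≠ N) : μ - C (i : K) * a1 ≠ 0 := by
    intro h0
    have := hQ i hi hiN
    rw [h0, natDegree_zero] at this; omega
  have hasc := H.ascent ht hd htd (N := N) (fun i hi hNi => hQ i hi hNi.ne')
  have hdesc {k : ℕ} (hk : k ≤ N) (hne : h k ≠ 0)
      (hlt : (h (k + 1)).natDegree < (h k).natDegree + a1.natDegree) : False :=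
    H.descent ht hd htd.le (by omega) (fun i hi => (hQ i (by omega) (by omega)).ge) hne hlt
  have hrN := H.recurrence N hN
  rw [hρ, zero_mul, zero_sub] at hrN
  rcases eq_or_lt_of_le hN with rfl | hNn
  · rw [H.vanish (N + 2) (by omega), mul_zero, neg_zero] at hrN
    have h0 := (IsShift.natDegree_eq_zero (by omega) hrN).1
    by_cases hU : h N = 0
    · obtain ⟨k, rfl⟩ : ∃ k, N = k + 1 := ⟨N - 1, by omega⟩
      have h2 := H.recurrence k (by omega)
      rw [hU, mul_zero, zero_sub] at h2
      have h3 := ht.natDegree_eq (by omega) h2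
        (neg_ne_zero.2 (mul_ne_zero (C_ne_zero.2 (hcN k)) H.top_ne))
      exact hdesc (by omega) h3.1 (by rw [hU, natDegree_zero]; omega)
    · exact hdesc le_rfl hU (by rw [H.top_natDegree]; omega)
  · obtain ⟨hB, -, hB3⟩ := hasc (N + 2) (by omega) (by omega)
    obtain ⟨hA, -, hA3⟩ := hasc (N + 1) (by omega) (by omega)
    replace hA3 := hA3 (by omega)
    obtain ⟨hU, hU2⟩ := ht.natDegree_eq (by omega) hrN
      (neg_ne_zero.2 (mul_ne_zero (C_ne_zero.2 (hcN N)) hB))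
    rw [natDegree_neg, natDegree_C_mul (hcN N)] at hU2
    obtain ⟨k, rfl⟩ : ∃ k, N = k + 1 := by
      rcases N with - | k
      · exact (hU H.zero).elim
      · exact ⟨k, rfl⟩
    have hrA := H.recurrence (k + 1 + 1) (by omega)
    have hrV := H.recurrence k (by omega)
    have hμ : μ = C ((k + 1 : ℕ) : K) * a1 := sub_eq_zero.1 hρ
    simp only [add_assoc, Nat.reduceAdd] at *
    have e1 : μ - C (k : K) * a1 = a1 := by rw [hμ]; push_cast; simp only [C_add, C_1]; ring
    have e2 : μ - C ((k + 2 : ℕ) : K) * a1 = -a1 := by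
      rw [hμ]; push_cast; simp only [C_add, C_1, map_ofNat]; ring
    obtain ⟨m, rfl⟩ : ∃ m, n = m + k + 2 := ⟨n - k - 2, by omega⟩
    rw [e2, show m + k + 2 + 1 - (k + 2) = m + 1 by omega] at hrA
    rw [show m + k + 2 + 1 - (k + 1) = m + 2 by omega] at hrN
    obtain ⟨hR, hR2⟩ := resonance_aux (U := h (k + 1)) (A := h (k + 2)) (a2 := a2)
      (N := k + 1) (c := c) (a1 := a1) (e1 := m + 2) (e2 := (k - m) * c)
      (S := C ((k + 2) * (k + 3) * c ^ 2) * h (k + 4))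
      hc hd hA rfl (by omega) rfl (by
        by_cases hv : h (k + 4) = 0
        · rw [hv, mul_zero, degree_zero]; exact WithBot.bot_lt_coe _
        · have : k + 3 ≤ m + k + 2 := by
            by_contra h0; exact hv (H.vanish _ (by omega))
          have := hB3 (by omega)
          rw [degree_eq_natDegree (mul_ne_zero ?_ hv)]
          · have := natDegree_C_mul_le ((k + 2) * (k + 3) * c ^ 2) (h (k + 4))
            exact Nat.cast_lt.2 (by omega)
          · exact C_ne_zero.2 (mul_ne_zero (mul_ne_zero (by exact_mod_cast (k + 1).succ_ne_zero)
              (by exact_mod_cast (k + 2).succ_ne_zero)) (pow_ne_zero _ hc)))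
      (by
        rw [sub_eq_iff_eq_add] at hrA hrN
        rw [hrA, hrN]
        push_cast
        simp only [C_add, C_mul, C_1, C_sub, C_pow, map_ofNat]
        ring)
    rw [e1] at hrV
    obtain ⟨hV, hV2⟩ := ht.natDegree_eq (by omega) hrV hR
    refine hdesc (by omega) hV ?_
    rcases ht with ⟨h0, rfl⟩ | ⟨h0, rfl⟩ <;> rcases hR2 with h6 | ⟨h6, h7⟩
    · omega
    · exact (h6 h0).elim
    · omega
    · omega

/-- A chain is only possible if `deg a1 = deg a2`, and then it consists of constants. -/
theorem natDegree_eq (H : DarbouxChain c a1 a2 μ n h) (hn : 1 ≤ n) (hc : c ≠ 0)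
    (hdeg : 1 ≤ a1.natDegree ∨ 1 ≤ a2.natDegree) :
    1 ≤ a2.natDegree ∧ ∀ k, (h k).natDegree = 0 := by
  obtain ⟨t, ht⟩ := exists_isShift a2
  have ht' : 1 ≤ t → t = a2.natDegree := by rcases ht with ⟨-, rfl⟩ | ⟨-, rfl⟩ <;> omega
  have ht'' : 1 ≤ a2.natDegree → t = a2.natDegree := by
    rcases ht with ⟨h, rfl⟩ | ⟨-, rfl⟩
    · simp [h]
    · simp
  obtain ⟨e, he1, hte, he⟩ : ∃ e : ℕ, 1 ≤ e ∧ t ≤ e ∧ (e = 1 ∨ t = e) :=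
    ⟨(max t 1).toNat, by omega, by omega, by omega⟩
  by_cases hall : ∀ i < n + 1, e ≤ (μ - C (i : K) * a1).natDegree
  · refine (H.descent ht he1 hte le_rfl hall H.top_ne ?_).elim
    rw [H.vanish _ (by omega), natDegree_zero]; omega
  push Not at hall
  obtain ⟨N, hN, hNe⟩ := hall
  have hi (i : ℕ) : μ - C (i : K) * a1 = (μ - C (N : K) * a1) + C ((N : K) - i) * a1 := by
    rw [C_sub]; ring
  have hni {i : ℕ} (h : i ≠ N) : (C ((N : K) - i) * a1).natDegree = a1.natDegree :=
    natDegree_C_mul (sub_ne_zero.2 (by exact_mod_cast h.symm))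
  by_cases hd : a1.natDegree < e
  · refine (H.false_of_lt hn hc ht (by omega) ?_).elim
    rw [hi]
    have h1 := natDegree_add_le (μ - C (N : K) * a1) (C ((N : K) - n) * a1)
    have h2 := natDegree_C_mul_le ((N : K) - n) a1
    omega
  have hQ : ∀ i ≤ n, i ≠ N → (μ - C (i : K) * a1).natDegree = a1.natDegree := by
    intro i _ h
    rw [hi, natDegree_add_eq_right_of_natDegree_lt (by rw [hni h]; omega), hni h]
  by_cases htd : t < a1.natDegree
  · by_cases hρ : μ - C (N : K) * a1 = 0
    · exact (H.false_of_eq hn hc ht (by omega) htd (by omega) hQ hρ).elim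
    · exact (H.false_of_ne ht (by omega) htd (by omega) hQ hρ).elim
  · refine ⟨by omega, H.natDegree_eq_zero ht (by omega) fun i hin => ?_⟩
    rcases eq_or_ne i N with rfl | h
    · omega
    · rw [hQ i hin h]; omega

end DarbouxChain
end Chain

section Bivariate

variable {K : Type*} [Field K] {a0 a1 a2 : K[X]}

lemma derivation_C (D : Derivation K K[X][X] K[X][X]) (hDx : D (C X) = X) (p : K[X]) :
    D (C p) = C (derivative p) * X := by
  induction p using Polynomial.induction_on with
  | C a =>
    have : (C (C a) : K[X][X]) = algebraMap K K[X][X] a := rfl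
    rw [this, D.map_algebraMap]; simp
  | add p q hp hq => simp only [map_add, hp, hq, add_mul]
  | monomial n a h =>
    rw [pow_succ, ← mul_assoc, C_mul, D.leibniz, h, hDx, derivative_mul (g := X), derivative_X]
    simp only [smul_eq_mul, C_add, C_mul, C_1]
    ring

lemma exists_derivation_eq (D : Derivation K K[X][X] K[X][X]) (hDx : D (C X) = X)
    (F : K[X][X]) : ∃ G : K[X][X], (∀ k, G.coeff k = derivative (F.coeff k)) ∧
      D F = X * G + D X * derivative F := by
  induction F using Polynomial.induction_on with
  | C p =>
    refine ⟨C (derivative p), fun k => ?_, ?_⟩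
    · simp only [coeff_C]; split_ifs <;> simp
    · rw [derivation_C D hDx, derivative_C]; ring
  | add P Q hP hQ =>
    obtain ⟨G, hG, hG'⟩ := hP
    obtain ⟨H, hH, hH'⟩ := hQ
    refine ⟨G + H, fun k => by simp [hG, hH], ?_⟩
    rw [map_add, hG', hH', derivative_add]; ring
  | monomial n p h =>
    obtain ⟨G, hG, hG'⟩ := h
    refine ⟨G * X, fun k => ?_, ?_⟩
    · rw [pow_succ, ← mul_assoc]
      cases k with
      | zero => simp
      | succ k => rw [coeff_mul_X, coeff_mul_X, hG]
    · rw [pow_succ, ← mul_assoc, D.leibniz, hG', derivative_mul (g := X), derivative_X]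
      simp only [smul_eq_mul]
      ring

section Coeff

variable {D : Derivation K K[X][X] K[X][X]} (hDx : D (C X) = X)
  (hDy : D X = C a2 * X ^ 2 + C a1 * X + C a0)
include hDx hDy

lemma coeff_derivation_zero (F : K[X][X]) : (D F).coeff 0 = a0 * F.coeff 1 := by
  obtain ⟨G, -, hG⟩ := exists_derivation_eq D hDx F
  rw [hG, hDy]
  simp [mul_coeff_zero, coeff_derivative]

lemma coeff_derivation_succ (F : K[X][X]) (k : ℕ) : (D F).coeff (k + 1) =
    derivative (F.coeff k) + C (k : K) * a2 * F.coeff k + C ((k + 1 : ℕ) : K) * a1 * F.coeff (k + 1)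
      + C ((k + 2 : ℕ) : K) * a0 * F.coeff (k + 2) := by
  obtain ⟨G, hG', hG⟩ := exists_derivation_eq D hDx F
  rw [hG, hDy]
  simp only [add_mul, mul_assoc, coeff_add, coeff_C_mul, coeff_X_mul, coeff_X_pow_mul', hG',
    coeff_derivative]
  rcases k with - | k
  · simp only [zero_add, map_ofNat, Nat.cast_ofNat]
    simp; ring
  · rw [if_pos (by omega), show k + 1 + 1 - 2 = k by omega]
    push_cast
    simp only [C_add, C_1, map_ofNat, map_natCast]
    ring

lemma natDegree_derivation_le (F : K[X][X]) : (D F).natDegree ≤ F.natDegree + 1 := by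
  rw [natDegree_le_iff_coeff_eq_zero]
  intro k hk
  obtain ⟨k, rfl⟩ : ∃ j, k = j + 1 := ⟨k - 1, by omega⟩
  rw [coeff_derivation_succ hDx hDy, coeff_eq_zero_of_natDegree_lt (n := k) (by omega),
    coeff_eq_zero_of_natDegree_lt (n := k + 1) (by omega),
    coeff_eq_zero_of_natDegree_lt (n := k + 2) (by omega)]
  simp

variable [CharZero K]

/-- The coefficients of a Darboux polynomial form a chain. -/
lemma exists_darbouxChain {c : K} (ha0 : a0 = C c) {F Λ : K[X][X]} (hF : F ≠ 0)
    (hΛ : D F = Λ * F) :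
    ∃ μ, DarbouxChain c a1 a2 μ F.natDegree (fun k => (X * F).coeff k) := by
  set n := F.natDegree with hn
  have hΛ1 : Λ.natDegree ≤ 1 := by
    rcases eq_or_ne Λ 0 with rfl | h0
    · simp
    · have := natDegree_derivation_le hDx hDy F
      rw [hΛ, natDegree_mul h0 hF] at this
      omega
  obtain ⟨l, μ, rfl⟩ := exists_eq_X_add_C_of_natDegree_le_one hΛ1
  have hlc : F.coeff n ≠ 0 := leadingCoeff_ne_zero.2 hF
  have hc (k : ℕ) := congrArg (fun p => p.coeff (k + 1)) hΛ
  simp only [coeff_derivation_succ hDx hDy, add_mul, mul_assoc, coeff_add, coeff_C_mul,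
    coeff_X_mul] at hc
  have htop := hc n
  rw [coeff_eq_zero_of_natDegree_lt (n := n + 1) (by omega),
    coeff_eq_zero_of_natDegree_lt (n := n + 2) (by omega)] at htop
  simp only [mul_zero, add_zero] at htop
  have hder : derivative (F.coeff n) = 0 := by
    by_contra h0
    have h1 : derivative (F.coeff n) = (l - C (n : K) * a2) * F.coeff n := by
      rw [sub_mul, ← htop]; ring
    have := degree_derivative_lt hlc
    rw [h1, degree_mul] at this
    have h2 : (0 : WithBot ℕ) ≤ (l - C (n : K) * a2).degree := by
      rw [zero_le_degree_iff]; rintro h3; rw [h3, zero_mul] at h1; exact h0 h1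
    exact (this.trans_le (le_add_of_nonneg_left h2)).false
  have hl : l = C (n : K) * a2 := by
    rw [hder, zero_add, ← mul_assoc] at htop
    exact (mul_right_cancel₀ hlc htop).symm
  refine ⟨μ, by simp, by simpa using hlc, ?_, fun k hk => ?_, fun k hk => ?_⟩
  · simpa using derivative_eq_zero.1 hder
  · obtain ⟨k, rfl⟩ : ∃ j, k = j + 1 := ⟨k - 1, by omega⟩
    simpa using coeff_eq_zero_of_natDegree_lt (p := F) (n := k) (by omega)
  · rcases k with - | k
    · have h0 := congrArg (fun p => p.coeff 0) hΛ
      simp only [coeff_derivation_zero hDx hDy, mul_coeff_zero] at h0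
      simp [mul_coeff_zero, ha0] at h0 ⊢
      rw [h0]; ring
    · simp only [coeff_X_mul, hl] at hc ⊢
      have := hc k
      obtain ⟨m, hm⟩ : ∃ m, n = m + k + 1 := ⟨n - k - 1, by omega⟩
      rw [show n + 1 - (k + 1) = m + 1 by omega]
      rw [hm, ha0] at this
      push_cast at this ⊢
      simp only [C_add, C_mul, C_1, map_ofNat] at this ⊢
      linear_combination this

/-- A prime Darboux polynomial gives an invariant line `y = const`. -/
lemma exists_of_darboux {c : K} (hc : c ≠ 0) (ha0 : a0 = C c)
    (hdeg : 1 ≤ a1.natDegree ∨ 1 ≤ a2.natDegree) {F Λ : K[X][X]} (hF : Prime F)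
    (hn : 1 ≤ F.natDegree) (hΛ : D F = Λ * F) :
    ∃ l : K, l ≠ 0 ∧ a2 = C l * a1 - C (l ^ 2) * a0 := by
  obtain ⟨μ, H⟩ := exists_darbouxChain hDx hDy ha0 hF.ne_zero hΛ
  obtain ⟨hd2, hconst⟩ := H.natDegree_eq hn hc hdeg
  replace hconst (k : ℕ) : F.coeff k = C ((F.coeff k).coeff 0) :=
    eq_C_of_natDegree_eq_zero (by simpa using hconst (k + 1))
  obtain ⟨G, hG, hG'⟩ := exists_derivation_eq D hDx F
  have hG0 : G = 0 := by
    ext1 k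
    rw [hG, hconst, derivative_C, coeff_zero]
  rw [hG0, mul_zero, zero_add, hΛ] at hG'
  have hdvd : F ∣ D X := by
    refine (hF.dvd_or_dvd (Dvd.intro_left Λ hG')).resolve_right fun h => ?_
    have h0 : derivative F ≠ 0 := by
      intro h0; rw [derivative_eq_zero] at h0; omega
    have := natDegree_le_of_dvd h h0
    rw [natDegree_derivative] at this; omega
  obtain ⟨Q, hQ⟩ := hdvd
  rw [hDy] at hQ
  have ha2 : a2 ≠ 0 := by rintro rfl; simp at hd2
  have hq : (C a2 * X ^ 2 + C a1 * X + C a0).natDegree = 2 := natDegree_quadratic ha2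
  have hq0 : (C a2 * X ^ 2 + C a1 * X + C a0) ≠ 0 := by
    intro h; rw [h, natDegree_zero] at hq; omega
  have hQ0 : Q ≠ 0 := by rintro rfl; rw [mul_zero] at hQ; exact hq0 hQ
  have hdeg2 := congrArg natDegree hQ
  rw [hq, natDegree_mul hF.ne_zero hQ0] at hdeg2
  have h0 : (C a2 * X ^ 2 + C a1 * X + C a0).coeff 0 = a0 := by simp
  have h1 : (C a2 * X ^ 2 + C a1 * X + C a0).coeff 1 = a1 := by simp [coeff_C]
  have h2 : (C a2 * X ^ 2 + C a1 * X + C a0).coeff 2 = a2 := by simp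
  rw [hQ] at h0 h1 h2
  rcases (show F.natDegree = 1 ∨ F.natDegree = 2 by omega) with hF1 | hF2
  · obtain ⟨p, r, hpr⟩ := exists_eq_X_add_C_of_natDegree_le_one hF1.le
    obtain ⟨s, u, hsu⟩ := exists_eq_X_add_C_of_natDegree_le_one (show Q.natDegree ≤ 1 by omega)
    have hp : p = C (p.coeff 0) := by simpa [hpr] using hconst 1
    have hr : r = C (r.coeff 0) := by simpa [hpr] using hconst 0
    have hexp : F * Q = C (p * s) * X ^ 2 + C (p * u + r * s) * X + C (r * u) := by
      rw [hpr, hsu]; simp only [C_mul, C_add]; ring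
    rw [hexp] at h0 h1 h2
    replace h0 : r * u = a0 := by rw [← h0]; simp
    replace h1 : p * u + r * s = a1 := by
      rw [← h1]; simp only [coeff_add, coeff_C_mul, coeff_X_pow, coeff_X, coeff_C]; simp
    replace h2 : p * s = a2 := by
      rw [← h2]; simp only [coeff_add, coeff_C_mul, coeff_X_pow, coeff_X, coeff_C]; simp
    have hr0 : r.coeff 0 ≠ 0 := by
      intro h; rw [hr, h, ha0] at h0; simp at h0; exact hc (C_eq_zero.1 h0.symm)
    have hp0 : p.coeff 0 ≠ 0 := by
      intro h; rw [hp, h, C_0, zero_mul] at h2; exact ha2 h2.symm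
    refine ⟨p.coeff 0 / r.coeff 0, div_ne_zero hp0 hr0, ?_⟩
    have hl : p = C (p.coeff 0 / r.coeff 0) * r := by
      conv_rhs => rw [hr]
      conv_lhs => rw [hp]
      rw [← C_mul]; simp [div_mul_cancel₀ _ hr0]
    rw [← h0, ← h1, ← h2, C_pow]
    generalize C (p.coeff 0 / r.coeff 0) = L at hl
    rw [hl]; ring
  · obtain ⟨u, rfl⟩ := natDegree_eq_zero.1 (show Q.natDegree = 0 by omega)
    simp only [coeff_mul_C] at h0 h2
    rw [hconst, ha0] at h0
    rw [hconst] at h2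
    have hu0 : u ≠ 0 := by rintro rfl; simp at h0; exact hc (C_eq_zero.1 h0.symm)
    have hf0 : C ((F.coeff 0).coeff 0) ≠ 0 := by
      intro h; rw [h, zero_mul] at h0; exact hc (C_eq_zero.1 h0.symm)
    have h3 := congrArg natDegree h0
    rw [natDegree_mul hf0 hu0, natDegree_C, natDegree_C] at h3
    have h4 := natDegree_C_mul_le ((F.coeff 2).coeff 0) u
    rw [h2] at h4
    omega

/-- A proper stable prime ideal contains no nonzero polynomial in `x` alone. -/
lemma eq_zero_of_C_mem {c : K} (hc : c ≠ 0) (ha0 : a0 = C c) {P : Ideal K[X][X]} (hP : P.IsPrime)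
    (hD : ∀ a ∈ P, D a ∈ P) {g : K[X]} (hg : C g ∈ P) : g = 0 := by
  by_contra hg0
  have hunit {b : K} (hb : b ≠ 0) (h : C (C b) ∈ P) : False :=
    hP.ne_top (P.eq_top_of_isUnit_mem h ((IsUnit.mk0 b hb).map (C.comp C : K →+* K[X][X])))
  have h1 := hD _ hg
  rw [derivation_C D hDx] at h1
  rcases hP.mem_or_mem h1 with h2 | h2
  · by_cases h3 : derivative g = 0
    · rw [derivative_eq_zero] at h3
      rw [eq_C_of_natDegree_eq_zero h3] at hg hg0
      exact hunit (C_ne_zero.1 hg0) hg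
    · exact h3 (eq_zero_of_C_mem hc ha0 hP hD h2)
  · have h3 := hD _ h2
    rw [hDy, ha0] at h3
    refine hunit hc ((Ideal.add_mem_iff_right _ ?_).1 h3)
    exact P.add_mem (P.mul_mem_left _ (Ideal.pow_mem_of_mem _ h2 _ (by norm_num)))
      (P.mul_mem_left _ h2)
termination_by g.natDegree
decreasing_by
  exact natDegree_derivative_lt fun h => h3 (derivative_of_natDegree_zero h)

end Coeff

/-- A nonzero prime ideal of `R[Y]` meeting `R` trivially is, up to denominators, generated by a
prime polynomial. -/
lemma exists_prime_forall_dvd {R : Type*} [CommRing R] [IsDomain R] [UniqueFactorizationMonoid R]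
    {P : Ideal R[X]} (hP : P.IsPrime) (hP0 : P ≠ ⊥) (hC : ∀ g : R, C g ∈ P → g = 0) :
    ∃ F ∈ P, Prime F ∧ 1 ≤ F.natDegree ∧ ∀ G ∈ P, F ∣ G := by
  classical
  have hex : ∃ n, ∃ F ∈ P, Prime F ∧ F.natDegree = n := by
    obtain ⟨F, h, h'⟩ := hP.exists_mem_prime_of_ne_bot hP0
    exact ⟨_, F, h, h', rfl⟩
  obtain ⟨F, hFP, hF, hFn⟩ := Nat.find_spec hex
  have hmin : ∀ G ∈ P, G ≠ 0 → F.natDegree ≤ G.natDegree := by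
    intro G hG hG0
    obtain ⟨H, hHP, hH, hHG⟩ : ∃ H ∈ P, Prime H ∧ H ∣ G := by
      obtain ⟨u, hu⟩ := UniqueFactorizationMonoid.factors_prod hG0
      rw [← hu, P.mul_unit_mem_iff_mem u.isUnit, hP.multiset_prod_mem_iff_exists_mem] at hG
      obtain ⟨H, hHG, hHP⟩ := hG
      exact ⟨H, hHP, UniqueFactorizationMonoid.prime_of_factor H hHG,
        UniqueFactorizationMonoid.dvd_of_mem_factors hHG⟩
    rw [hFn]
    exact (Nat.find_min' hex ⟨H, hHP, hH, rfl⟩).trans (natDegree_le_of_dvd hHG hG0)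
  have hn : 1 ≤ F.natDegree := by
    by_contra h
    have h' := eq_C_of_natDegree_eq_zero (show F.natDegree = 0 by omega)
    have := hC (F.coeff 0) (h' ▸ hFP)
    rw [this, C_0] at h'
    exact hF.ne_zero h'
  refine ⟨F, hFP, hF, hn, ?_⟩
  suffices H : ∀ m, ∀ G ∈ P, G.natDegree ≤ m → F ∣ G from fun G hG => H _ G hG le_rfl
  intro m
  induction m using Nat.strong_induction_on with
  | _ m ih =>
    intro G hG hGm
    rcases eq_or_ne G 0 with rfl | hG0
    · exact dvd_zero _
    have hle := hmin G hG hG0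
    have hlt := natDegree_cancelLeads_lt_of_natDegree_le_natDegree hle (by omega)
    have hmem : F.cancelLeads G ∈ P :=
      P.sub_mem (P.mul_mem_left _ hG) (P.mul_mem_left _ hFP)
    have hd := ih _ (hlt.trans_le hGm) _ hmem le_rfl
    rw [cancelLeads, Nat.sub_eq_zero_of_le hle, pow_zero, mul_one,
      dvd_sub_left (Dvd.intro_left _ rfl)] at hd
    refine (hF.dvd_or_dvd hd).resolve_left fun h => ?_
    have := natDegree_le_of_dvd h (C_ne_zero.2 (leadingCoeff_ne_zero.2 hF.ne_zero))
    rw [natDegree_C] at this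
    omega

end Bivariate

section StablePrime

variable {K R : Type*} [Field K] [CommRing R] [Algebra K R] (D : Derivation K R R)
  {M : Ideal R}

lemma iterate_derivation_mul_mem (k : ℕ) : ∀ (i j : ℕ) (a b : R),
    (∀ l < i, D^[l] a ∈ M) → (∀ l < j, D^[l] b ∈ M) → k < i + j → D^[k] (a * b) ∈ M := by
  induction k with
  | zero =>
    intro i j a b ha hb hk
    rcases Nat.eq_zero_or_pos i with h | h
    · exact M.mul_mem_left _ (hb 0 (by omega))
    · exact M.mul_mem_right _ (ha 0 h)
  | succ k ih =>
    intro i j a b ha hb hk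
    rw [Function.iterate_succ_apply, D.leibniz, smul_eq_mul, smul_eq_mul, iterate_map_add]
    refine M.add_mem (ih i (j - 1) _ _ ha (fun l hl => ?_) (by omega))
      (ih j (i - 1) _ _ hb (fun l hl => ?_) (by omega))
    · rw [← Function.iterate_succ_apply]; exact hb _ (by omega)
    · rw [← Function.iterate_succ_apply]; exact ha _ (by omega)

lemma iterate_derivation_mul_sub_mem (s : ℕ) : ∀ (i j : ℕ) (a b : R), s = i + j →
    (∀ l < i, D^[l] a ∈ M) → (∀ l < j, D^[l] b ∈ M) →
    D^[i + j] (a * b) - ((i + j).choose i : R) * (D^[i] a * D^[j] b) ∈ M := by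
  induction s with
  | zero =>
    intro i j a b hs _ _
    obtain ⟨rfl, rfl⟩ : i = 0 ∧ j = 0 := by omega
    simp
  | succ s ih =>
    intro i j a b hs ha hb
    have ha' : ∀ l < i - 1, D^[l] (D a) ∈ M := fun l hl => by
      rw [← Function.iterate_succ_apply]; exact ha _ (by omega)
    have hb' : ∀ l < j - 1, D^[l] (D b) ∈ M := fun l hl => by
      rw [← Function.iterate_succ_apply]; exact hb _ (by omega)
    rw [← hs, Function.iterate_succ_apply, D.leibniz, smul_eq_mul, smul_eq_mul, iterate_map_add,
      mul_comm b]
    rcases i with - | i <;> rcases j with - | j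
    · omega
    · have h1 := ih 0 j a (D b) (by omega) ha hb'
      have h2 := iterate_derivation_mul_mem D s 0 (j + 1) (D a) b (by simp) hb (by omega)
      obtain rfl : s = j := by omega
      convert M.add_mem h1 h2 using 1
      simp
      ring
    · have h1 := ih i 0 (D a) b (by omega) ha' hb
      have h2 := iterate_derivation_mul_mem D s (i + 1) 0 a (D b) ha (by simp) (by omega)
      obtain rfl : s = i := by omega
      convert M.add_mem h1 h2 using 1
      simp
      ring
    · have h1 := ih (i + 1) j a (D b) (by omega) ha hb'
      have h2 := ih i (j + 1) (D a) b (by omega) ha' hb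
      obtain rfl : s = i + j + 1 := by omega
      convert M.add_mem h1 h2 using 1
      rw [Nat.choose_succ_succ (i + j + 1) i, show i + 1 + j = i + j + 1 by omega,
        show i + (j + 1) = i + j + 1 by omega]
      simp only [Function.iterate_succ_apply]
      push_cast
      ring

/-- A proper stable ideal is contained in a stable prime ideal. -/
lemma exists_stable_prime [CharZero K] {I : Ideal R} (hI : ∀ a ∈ I, D a ∈ I) (hne : I ≠ ⊤) :
    ∃ P : Ideal R, P.IsPrime ∧ (∀ a ∈ P, D a ∈ P) ∧ I ≤ P := by
  classical
  obtain ⟨M, hM, hIM⟩ := I.exists_le_maximal hne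
  have hMp := hM.isPrime
  let P : Ideal R :=
    { carrier := {a | ∀ k, D^[k] a ∈ M}
      add_mem' := fun ha hb k => by rw [iterate_map_add]; exact M.add_mem (ha k) (hb k)
      zero_mem' := fun k => by rw [iterate_map_zero]; exact M.zero_mem
      smul_mem' := fun r a ha k => iterate_derivation_mul_mem D k 0 (k + 1) r a (by simp)
        (fun l _ => ha l) (by omega) }
  have hP (a : R) : a ∈ P ↔ ∀ k, D^[k] a ∈ M := Iff.rfl
  refine ⟨P, ⟨fun h => ?_, fun {a b} hab => ?_⟩, fun a ha k => ?_, fun a ha => ?_⟩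
  · exact hMp.ne_top ((Ideal.eq_top_iff_one M).2 ((hP 1).1 (h ▸ Submodule.mem_top) 0))
  · by_contra! hcon
    simp only [hP, not_forall] at hcon
    obtain ⟨h1, h2⟩ := hcon
    have h3 := iterate_derivation_mul_sub_mem D _ _ _ a b rfl
      (fun l hl => not_not.1 (Nat.find_min h1 hl)) (fun l hl => not_not.1 (Nat.find_min h2 hl))
    set i := Nat.find h1
    set j := Nat.find h2
    have h4 := M.sub_mem (hab (i + j)) h3
    rw [sub_sub_cancel] at h4
    have hu : IsUnit (((i + j).choose i : ℕ) : R) := by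
      have : (((i + j).choose i : ℕ) : K) ≠ 0 := by
        exact_mod_cast (Nat.choose_pos (by omega)).ne'
      simpa using (IsUnit.mk0 _ this).map (algebraMap K R)
    rcases hMp.mem_or_mem ((Ideal.unit_mul_mem_iff_mem M hu).1 h4) with h | h
    · exact Nat.find_spec h1 h
    · exact Nat.find_spec h2 h
  · exact ha (k + 1)
  · have : ∀ k, D^[k] a ∈ I := by
      intro k
      induction k with
      | zero => exact ha
      | succ k ih => rw [Function.iterate_succ_apply']; exact hI _ ih
    exact fun k => hIM (this k)

end StablePrime

lemma Derivation.IsSimple.of_equiv {K R S : Type*} [CommRing K] [CommRing R] [CommRing S]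
    [Algebra K R] [Algebra K S] {D : Derivation K R R} {D' : Derivation K S S} (e : R ≃ₐ[K] S)
    (he : ∀ a, e (D a) = D' (e a)) (hD : D.IsSimple) : D'.IsSimple := by
  intro I hI
  rcases hD (I.comap e) (fun a ha => by
    rw [Ideal.mem_comap] at ha ⊢; rw [he]; exact hI _ ha) with h | h
  · left
    rw [eq_bot_iff]
    intro b hb
    have : e.symm b ∈ I.comap e := by rw [Ideal.mem_comap, e.apply_symm_apply]; exact hb
    rw [h, Ideal.mem_bot] at this
    rw [Ideal.mem_bot, ← e.apply_symm_apply b, this, map_zero]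
  · right
    rw [Ideal.eq_top_iff_one, ← map_one e, ← Ideal.mem_comap, h]
    exact Submodule.mem_top

lemma Derivation.IsSimple.isUnit_of_dvd {K R : Type*} [CommRing K] [CommRing R] [Algebra K R]
    {D : Derivation K R R} (hD : D.IsSimple) {f : R} (hf : f ≠ 0) (h : f ∣ D f) : IsUnit f := by
  refine Ideal.span_singleton_eq_top.1
    ((hD (Ideal.span {f}) fun a ha => ?_).resolve_left fun h => ?_)
  · obtain ⟨b, rfl⟩ := Ideal.mem_span_singleton.1 ha
    rw [Ideal.mem_span_singleton, D.leibniz]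
    exact dvd_add (Dvd.intro _ rfl) (h.mul_left _)
  · exact hf (Ideal.span_singleton_eq_bot.1 h)

section Main

variable {K : Type*} [Field K] {a0 a1 a2 : K[X]}
  {D : Derivation K K[X][X] K[X][X]} (hDx : D (C X) = X)
  (hDy : D X = C a2 * X ^ 2 + C a1 * X + C a0)
include hDx hDy

lemma degree_eq_zero_of_isSimple (hD : D.IsSimple) : a0.degree = 0 := by
  have hX : X ∈ Ideal.span {C a0, (X : K[X][X])} := Ideal.subset_span (by simp)
  have ha : C a0 ∈ Ideal.span {C a0, (X : K[X][X])} := Ideal.subset_span (by simp)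
  have htop := (hD (Ideal.span {C a0, X}) fun a h => ?_).resolve_left fun h => ?_
  · rw [Ideal.eq_top_iff_one, Ideal.mem_span_pair] at htop
    obtain ⟨p, q, hpq⟩ := htop
    have := congrArg (fun r => r.coeff 0) hpq
    simp [mul_coeff_zero] at this
    exact degree_eq_zero_of_isUnit (IsUnit.of_mul_eq_one_right _ this)
  · obtain ⟨p, q, rfl⟩ := Ideal.mem_span_pair.1 h
    rw [map_add, D.leibniz, D.leibniz, derivation_C D hDx, hDy]
    simp only [smul_eq_mul]
    refine add_mem (add_mem ?_ ?_) (add_mem ?_ ?_)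
    · exact Ideal.mul_mem_left _ _ (Ideal.mul_mem_left _ _ hX)
    · exact Ideal.mul_mem_right _ _ ha
    · refine Ideal.mul_mem_left _ _ (add_mem (add_mem ?_ (Ideal.mul_mem_left _ _ hX)) ha)
      exact Ideal.mul_mem_left _ _ (Ideal.pow_mem_of_mem _ hX _ (by norm_num))
    · exact Ideal.mul_mem_right _ _ hX
  · rw [h, Ideal.mem_bot] at hX
    exact X_ne_zero hX

lemma not_exists_of_isSimple (hD : D.IsSimple) :
    ¬ ∃ l : K, l ≠ 0 ∧ a2 = C l * a1 - C (l ^ 2) * a0 := by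
  rintro ⟨l, hl, h⟩
  have hC : C (C l : K[X]) ≠ 0 := C_ne_zero.2 (C_ne_zero.2 hl)
  have hdeg : (C (C l) * X + C 1 : K[X][X]).natDegree = 1 := natDegree_linear (C_ne_zero.2 hl)
  have hu : IsUnit (C (C l) * X + C 1 : K[X][X]) := by
    refine hD.isUnit_of_dvd (fun h0 => by rw [h0, natDegree_zero] at hdeg; omega) ?_
    refine ⟨C (C l) * (C a1 * X - C a0 * (C (C l) * X - 1)), ?_⟩
    rw [map_add, D.leibniz, derivation_C D hDx, derivation_C D hDx, hDy, h]
    simp only [smul_eq_mul, derivative_C, derivative_one, C_0, C_sub, C_mul, C_pow, C_1]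
    ring
  rw [natDegree_eq_zero_of_isUnit hu] at hdeg
  omega

lemma one_le_degree_of_isSimple (hD : D.IsSimple) : 1 ≤ a1.degree ∨ 1 ≤ a2.degree := by
  have h0 := degree_eq_zero_of_isSimple hDx hDy hD
  by_contra! hcon
  have hconst {p : K[X]} (h : p.degree < 1) : p = C (p.coeff 0) :=
    eq_C_of_degree_le_zero (by
      rw [← Nat.WithBot.lt_one_iff_le_zero]; exact h)
  have hDC {p : K[X]} (h : p.degree < 1) : D (C p) = 0 := by
    rw [derivation_C D hDx, hconst h, derivative_C]; simp
  have h0' : a0.degree < 1 := by rw [h0]; exact zero_lt_one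
  have ha0 : a0 ≠ 0 := by rintro rfl; simp at h0
  have hDq : D X ∣ D (D X) := by
    refine ⟨2 * C a2 * X + C a1, ?_⟩
    conv_lhs => rw [hDy]
    rw [map_add, map_add, D.leibniz, D.leibniz, D.leibniz_pow, hDC hcon.1, hDC hcon.2, hDC h0']
    simp only [smul_eq_mul, nsmul_eq_mul]
    push_cast
    ring
  have hcoeff0 : (D X).coeff 0 = a0 := by rw [hDy]; simp
  have hcoeff1 : (D X).coeff 1 = a1 := by rw [hDy]; simp [coeff_C]
  have hcoeff2 : (D X).coeff 2 = a2 := by rw [hDy]; simp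
  have hu : IsUnit (D X) :=
    hD.isUnit_of_dvd (fun h => ha0 (by rw [← hcoeff0, h, coeff_zero])) hDq
  have hdeg := natDegree_eq_zero_of_isUnit hu
  have h1 : a1 = 0 := by rw [← hcoeff1]; exact coeff_eq_zero_of_natDegree_lt (by omega)
  have h2 : a2 = 0 := by rw [← hcoeff2]; exact coeff_eq_zero_of_natDegree_lt (by omega)
  rw [h1, h2, hconst h0'] at hDy
  -- here `y ^ 2 - 2 * a0 * x` is a constant of the derivation
  have hdeg2 : (X ^ 2 - C (2 * C (a0.coeff 0) * X) : K[X][X]).natDegree = 2 :=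
    natDegree_X_pow_sub_C
  have hu2 : IsUnit (X ^ 2 - C (2 * C (a0.coeff 0) * X) : K[X][X]) := by
    refine hD.isUnit_of_dvd (fun h => by rw [h, natDegree_zero] at hdeg2; omega) ⟨0, ?_⟩
    rw [map_sub, D.leibniz_pow, derivation_C D hDx, hDy]
    simp only [derivative_mul, derivative_ofNat, derivative_C, derivative_X, smul_eq_mul,
      nsmul_eq_mul, C_add, C_mul, C_0, C_1, map_ofNat]
    push_cast
    ring
  rw [natDegree_eq_zero_of_isUnit hu2] at hdeg2
  omega

variable [CharZero K]

lemma isSimple_of_conditions (h0 : a0.degree = 0) (hdeg : 1 ≤ a1.degree ∨ 1 ≤ a2.degree)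
    (hl : ¬ ∃ l : K, l ≠ 0 ∧ a2 = C l * a1 - C (l ^ 2) * a0) : D.IsSimple := by
  obtain ⟨c, hc, ha0⟩ : ∃ c : K, c ≠ 0 ∧ a0 = C c := by
    have h1 := eq_C_of_degree_eq_zero h0
    refine ⟨a0.coeff 0, fun h => ?_, h1⟩
    rw [h, C_0] at h1
    simp [h1] at h0
  have hdeg' : 1 ≤ a1.natDegree ∨ 1 ≤ a2.natDegree := by
    refine hdeg.imp (fun h => ?_) (fun h => ?_) <;>
    · rw [← Nat.cast_one] at h; exact le_natDegree_of_coe_le_degree h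
  intro I hI
  by_contra! hcon
  obtain ⟨P, hP, hPD, hIP⟩ := exists_stable_prime D hI hcon.2
  obtain ⟨F, hFP, hF, hn, hdvd⟩ := exists_prime_forall_dvd hP
    (fun h => hcon.1 (le_bot_iff.1 (h ▸ hIP)))
    (fun g hg => eq_zero_of_C_mem hDx hDy hc ha0 hP hPD hg)
  obtain ⟨Λ, hΛ⟩ := hdvd _ (hPD F hFP)
  exact hl (exists_of_darboux hDx hDy hc ha0 hdeg' hF hn (hΛ.trans (mul_comm _ _)))

end Main

/-- `K[x, y]` as polynomials in `y` over `K[x]`. -/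
noncomputable def mvPolynomialFinTwoEquiv (K : Type*) [CommRing K] :
    MvPolynomial (Fin 2) K ≃ₐ[K] K[X][X] :=
  AlgEquiv.ofAlgHom (MvPolynomial.aeval ![C X, X])
    (Polynomial.eval₂AlgHom (Polynomial.aeval (MvPolynomial.X 0)) (MvPolynomial.X 1)
      (fun _ => mul_comm _ _))
    (by
      refine Polynomial.algHom_ext' (Polynomial.algHom_ext ?_) ?_
      · change MvPolynomial.aeval (R := K) ![C X, (X : K[X][X])] (eval₂ (Polynomial.aeval (R := K)
          (MvPolynomial.X (0 : Fin 2) : MvPolynomial (Fin 2) K)).toRingHom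
          (MvPolynomial.X 1) (C X)) = C X
        rw [eval₂_C]
        simp
      · change MvPolynomial.aeval (R := K) ![C X, (X : K[X][X])] (eval₂ (Polynomial.aeval (R := K)
          (MvPolynomial.X (0 : Fin 2) : MvPolynomial (Fin 2) K)).toRingHom
          (MvPolynomial.X 1) X) = X
        rw [eval₂_X]
        simp)
    (by
      ext i : 1
      fin_cases i
      · refine (congrArg _ (MvPolynomial.aeval_X _ _)).trans ((eval₂_C _ _).trans ?_)
        simp
      · exact (congrArg _ (MvPolynomial.aeval_X _ _)).trans (eval₂_X _ _))

theorem stmt_9 (K : Type*) [Field K] [CharZero K] (a0 a1 a2 : Polynomial K)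
    (D : Derivation K (MvPolynomial (Fin 2) K) (MvPolynomial (Fin 2) K))
    (hDx : D (MvPolynomial.X 0) = MvPolynomial.X 1)
    (hDy : D (MvPolynomial.X 1) =
      Polynomial.aeval (MvPolynomial.X 0) a2 * MvPolynomial.X 1 ^ 2 +
        Polynomial.aeval (MvPolynomial.X 0) a1 * MvPolynomial.X 1 +
        Polynomial.aeval (MvPolynomial.X 0) a0) :
    D.IsSimple ↔
      a0.degree = 0 ∧ (1 ≤ a1.degree ∨ 1 ≤ a2.degree) ∧
        ¬ ∃ l : K, l ≠ 0 ∧ a2 = Polynomial.C l * a1 - Polynomial.C (l ^ 2) * a0 := by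
  let e := mvPolynomialFinTwoEquiv K
  have he0 : e (MvPolynomial.X 0) = C X := by simp [e, mvPolynomialFinTwoEquiv]
  have he1 : e (MvPolynomial.X 1) = X := by simp [e, mvPolynomialFinTwoEquiv]
  have heC (p : K[X]) : e (Polynomial.aeval (MvPolynomial.X 0) p) = C p := by
    rw [← Polynomial.aeval_algHom_apply, he0]
    induction p using Polynomial.induction_on' with
    | add p q hp hq => rw [map_add, hp, hq, C_add]
    | monomial n a =>
      rw [Polynomial.aeval_monomial, ← C_pow, IsScalarTower.algebraMap_apply K K[X] K[X][X]]
      rw [Polynomial.algebraMap_eq, Polynomial.algebraMap_eq, ← C_mul, C_mul_X_pow_eq_monomial]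
  let D' : Derivation K K[X][X] K[X][X] :=
    Derivation.mk' (e.toLinearMap ∘ₗ D.toLinearMap ∘ₗ e.symm.toLinearMap) fun a b => by
      simp [D.leibniz]
  have hD' (a) : D' a = e (D (e.symm a)) := rfl
  have hx : D' (C X) = X := by rw [hD', ← he0, e.symm_apply_apply, hDx, he1]
  have hy : D' X = C a2 * X ^ 2 + C a1 * X + C a0 := by
    rw [hD', ← he1, e.symm_apply_apply, hDy]
    simp only [map_add, map_mul, map_pow, heC]
  have hiff : D.IsSimple ↔ D'.IsSimple :=
    ⟨.of_equiv e fun a => by rw [hD', e.symm_apply_apply],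
      .of_equiv e.symm fun a => by rw [hD', e.symm_apply_apply]⟩
  rw [hiff]
  exact ⟨fun h => ⟨degree_eq_zero_of_isSimple hx hy h, one_le_degree_of_isSimple hx hy h,
    not_exists_of_isSimple hx hy h⟩, fun ⟨h0, h1, h2⟩ => isSimple_of_conditions hx hy h0 h1 h2⟩
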